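/- arXiv:math/0701854 — 2 statements merged into one kernel-verified Lean document; each statement's English description precedes it below -/
import Mathlib

section
/- For all θ > 0 and σ > 0, -∫_0^∞ [1/σ² - (θ+1)·x(2σ+x)/(σ²(σ+x)²)] · (θ/σ)(1 + x/σ)^{-(θ+1)} dx = θ/(σ²(θ+2)). Here the bracketed integrand equals ∂²(log p_{θ,σ}(x))/∂σ², so this identity says that the (σ,σ) entry of the Fisher information matrix of the q-exponential family equals θ/(σ²(θ+2)). -/
open MeasureTheory

theorem hasDerivAt_one_add_div_rpow {σ a x : ℝ} (hσ : 0 < σ) (ha : 0 < a) (hx : 0 ≤ x) :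
    HasDerivAt (fun x : ℝ => -(σ / a) * (1 + x / σ) ^ (-a)) ((1 + x / σ) ^ (-(a + 1))) x := by
  have hu : 0 < 1 + x / σ := by positivity
  have h := ((((hasDerivAt_id x).div_const σ).const_add 1).rpow_const (p := -a)
    (Or.inl hu.ne')).const_mul (-(σ / a))
  refine h.congr_deriv ?_
  rw [show -a - 1 = -(a + 1) by ring]
  simp only [id]
  field_simp

theorem tendsto_one_add_div_rpow_neg {σ a : ℝ} (hσ : 0 < σ) (ha : 0 < a) :
    Filter.Tendsto (fun x : ℝ => -(σ / a) * (1 + x / σ) ^ (-a)) Filter.atTop (nhds 0) := by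
  have h : Filter.Tendsto (fun x : ℝ => 1 + x / σ) Filter.atTop Filter.atTop :=
    Filter.tendsto_atTop_add_const_left _ _ (Filter.tendsto_id.atTop_div_const hσ)
  simpa using ((tendsto_rpow_neg_atTop ha).comp h).const_mul (-(σ / a))

theorem integrableOn_Ioi_one_add_div_rpow {σ a : ℝ} (hσ : 0 < σ) (ha : 0 < a) :
    IntegrableOn (fun x : ℝ => (1 + x / σ) ^ (-(a + 1))) (Set.Ioi 0) := by
  refine integrableOn_Ioi_deriv_of_nonneg' (fun x hx => hasDerivAt_one_add_div_rpow hσ ha hx)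
    (fun x hx => ?_) (tendsto_one_add_div_rpow_neg hσ ha)
  have hx' : 0 < x := hx
  positivity

theorem integral_Ioi_one_add_div_rpow {σ a : ℝ} (hσ : 0 < σ) (ha : 0 < a) :
    ∫ x in Set.Ioi (0 : ℝ), (1 + x / σ) ^ (-(a + 1)) = σ / a := by
  rw [integral_Ioi_of_hasDerivAt_of_tendsto'
    (fun x hx => hasDerivAt_one_add_div_rpow hσ ha hx)
    (integrableOn_Ioi_one_add_div_rpow hσ ha) (tendsto_one_add_div_rpow_neg hσ ha)]
  simp



/-- The (σ,σ) entry of the Fisher information matrix of the q-exponential family: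
`-∫_0^∞ [1/σ² - (θ+1) x(2σ+x)/(σ²(σ+x)²)] (θ/σ)(1+x/σ)^{-(θ+1)} dx = θ/(σ²(θ+2))`,
where the bracketed term is `∂² log p_{θ,σ}(x) / ∂σ²`. -/
theorem qexp_fisher_sigma_sigma (θ σ : ℝ) (hθ : 0 < θ) (hσ : 0 < σ) :
    -∫ x in Set.Ioi (0 : ℝ),
        (1 / σ ^ 2 - (θ + 1) * (x * (2 * σ + x)) / (σ ^ 2 * (σ + x) ^ 2)) *
          ((θ / σ) * (1 + x / σ) ^ (-(θ + 1))) =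
      θ / (σ ^ 2 * (θ + 2)) := by
  have hθ2 : 0 < θ + 2 := by linarith
  have hcongr : ∀ x ∈ Set.Ioi (0 : ℝ),
      (1 / σ ^ 2 - (θ + 1) * (x * (2 * σ + x)) / (σ ^ 2 * (σ + x) ^ 2)) *
          ((θ / σ) * (1 + x / σ) ^ (-(θ + 1))) =
        θ * (θ + 1) / σ ^ 3 * (1 + x / σ) ^ (-(θ + 2 + 1)) -
          θ ^ 2 / σ ^ 3 * (1 + x / σ) ^ (-(θ + 1)) := by
    intro x hx
    have hx' : 0 < x := hx
    have hu : 0 < 1 + x / σ := by positivity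
    have hpow : (1 + x / σ) ^ (-(θ + 2 + 1)) =
        (1 + x / σ) ^ (-(θ + 1)) * (σ ^ 2 / (σ + x) ^ 2) := by
      rw [show -(θ + 2 + 1) = -(θ + 1) - (2 : ℕ) by push_cast; ring,
        Real.rpow_sub_natCast hu.ne',
        show 1 + x / σ = (σ + x) / σ by field_simp]
      field_simp
    rw [hpow]
    have hs : σ + x ≠ 0 := by positivity
    generalize (1 + x / σ) ^ (-(θ + 1)) = y
    field_simp
    ring
  rw [setIntegral_congr_fun measurableSet_Ioi hcongr,
    integral_sub ((integrableOn_Ioi_one_add_div_rpow hσ hθ2).const_mul _)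
      ((integrableOn_Ioi_one_add_div_rpow hσ hθ).const_mul _),
    integral_const_mul, integral_const_mul, integral_Ioi_one_add_div_rpow hσ hθ2,
    integral_Ioi_one_add_div_rpow hσ hθ]
  field_simp
  ring
end

section
/- For all θ > 0, σ > 0 and x₀ ≥ 0, ∫_{x₀}^∞ [x/(σ(σ+x)) - x₀/(σ(σ+x₀))] · (1 + x₀/σ)^θ (θ/σ)(1 + x/σ)^{-(θ+1)} dx = 1/((θ+1)(σ+x₀)). Here the bracketed integrand equals ∂²(log p_{θ,σ,x₀}(x))/∂θ∂σ, so this identity says that the off-diagonal entry of the Fisher information matrix of the left-censored q-exponential model equals -1/((θ+1)(σ+x₀)), i.e. the off-diagonal entry of the uncensored Fisher information matrix I(θ, σ+x₀). -/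
open MeasureTheory

/-- A primitive in `x` of `(c⁻¹ - u⁻¹) / σ * (c ^ θ * (θ / σ * u ^ (-(θ + 1))))`, where
`u = 1 + x / σ`. -/
noncomputable def censoredFisherPrimitive (θ σ c x : ℝ) : ℝ :=
  c ^ θ * (θ / σ) *
    ((1 + x / σ) ^ (-(θ + 1)) / (θ + 1) - (1 + x / σ) ^ (-θ) / (c * θ))

theorem hasDerivAt_censoredFisherPrimitive {θ σ x : ℝ} (hθ : 0 < θ) (hσ : σ ≠ 0) (c : ℝ)
    (hx : 0 < 1 + x / σ) :
    HasDerivAt (censoredFisherPrimitive θ σ c)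
      ((c⁻¹ - (1 + x / σ)⁻¹) / σ * (c ^ θ * ((θ / σ) * (1 + x / σ) ^ (-(θ + 1))))) x := by
  have hu : HasDerivAt (fun y : ℝ => 1 + y / σ) (1 / σ) x :=
    ((hasDerivAt_id x).div_const σ).const_add 1
  have hpow (r : ℝ) := hu.rpow_const (p := r) (Or.inl hx.ne')
  have hsub := ((hpow (-(θ + 1))).div_const (θ + 1)).sub ((hpow (-θ)).div_const (c * θ))
  refine (hsub.const_mul (c ^ θ * (θ / σ))).congr_deriv ?_
  rw [show -θ - 1 = -(θ + 1) by ring, Real.rpow_sub_one hx.ne']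
  have hθ1 : θ + 1 ≠ 0 := by positivity
  generalize (1 + x / σ) ^ (-(θ + 1)) = v
  generalize 1 + x / σ = u
  field_simp
  ring

theorem tendsto_censoredFisherPrimitive {θ σ : ℝ} (hθ : 0 < θ) (hσ : 0 < σ) (c : ℝ) :
    Filter.Tendsto (censoredFisherPrimitive θ σ c) Filter.atTop (nhds 0) := by
  have hu : Filter.Tendsto (fun x : ℝ => 1 + x / σ) Filter.atTop Filter.atTop :=
    Filter.tendsto_atTop_add_const_left _ 1 (Filter.tendsto_id.atTop_div_const hσ)
  have hpow (r : ℝ) (hr : 0 < r) := (tendsto_rpow_neg_atTop hr).comp hu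
  have hsub := ((hpow (θ + 1) (by positivity)).div_const (θ + 1)).sub
    ((hpow θ hθ).div_const (c * θ))
  have hmul := hsub.const_mul (c ^ θ * (θ / σ))
  rw [zero_div, zero_div, sub_zero, mul_zero] at hmul
  exact hmul

/-- The off-diagonal Fisher information term of the left-censored q-exponential model:
`∫_{x₀}^∞ [x/(σ(σ+x)) - x₀/(σ(σ+x₀))] p_{θ,σ,x₀}(x) dx = 1/((θ+1)(σ+x₀))`,
where the bracketed term is `∂² log p_{θ,σ,x₀}(x)/∂θ∂σ`; i.e. the censored Fisher
off-diagonal entry is `-1/((θ+1)(σ+x₀))`, that of the uncensored model at `(θ, σ+x₀)`. -/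
theorem qexp_censored_fisher_offdiagonal (θ σ x₀ : ℝ)
    (hθ : 0 < θ) (hσ : 0 < σ) (hx₀ : 0 ≤ x₀) :
    ∫ x in Set.Ioi x₀,
        (x / (σ * (σ + x)) - x₀ / (σ * (σ + x₀))) *
          ((1 + x₀ / σ) ^ θ * ((θ / σ) * (1 + x / σ) ^ (-(θ + 1)))) =
      1 / ((θ + 1) * (σ + x₀)) := by
  have hone (x : ℝ) (hx : 0 ≤ x) : 0 < 1 + x / σ := by positivity
  set c := 1 + x₀ / σ with hc
  have hc0 : 0 < c := hone x₀ hx₀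
  have hsc : σ + x₀ = σ * c := by rw [hc]; field_simp
  have hderiv : ∀ x ∈ Set.Ici x₀,
      HasDerivAt (censoredFisherPrimitive θ σ c)
        ((x / (σ * (σ + x)) - x₀ / (σ * (σ + x₀))) *
          (c ^ θ * ((θ / σ) * (1 + x / σ) ^ (-(θ + 1))))) x := by
    intro x hx
    have hx0 : 0 ≤ x := hx₀.trans hx
    convert hasDerivAt_censoredFisherPrimitive hθ hσ.ne' c (hone x hx0) using 1
    have hsx : 0 < σ + x := by positivity
    have hsx₀ : 0 < σ + x₀ := by positivity
    rw [hc]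
    field_simp
    ring
  have hnonneg : ∀ x ∈ Set.Ioi x₀,
      0 ≤ (x / (σ * (σ + x)) - x₀ / (σ * (σ + x₀))) *
          (c ^ θ * ((θ / σ) * (1 + x / σ) ^ (-(θ + 1)))) := by
    intro x hx
    rw [Set.mem_Ioi] at hx
    have hx0 : 0 ≤ x := hx₀.trans hx.le
    have hu := hone x hx0
    refine mul_nonneg (sub_nonneg.2 ?_) (by positivity)
    rw [div_le_div_iff₀ (by positivity) (by positivity)]
    nlinarith [mul_le_mul_of_nonneg_left hx.le (sq_nonneg σ)]
  rw [integral_Ioi_of_hasDerivAt_of_nonneg' hderiv hnonneg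
    (tendsto_censoredFisherPrimitive hθ hσ c), hsc, censoredFisherPrimitive, ← hc,
    Real.rpow_neg hc0.le, Real.rpow_neg hc0.le, Real.rpow_add_one hc0.ne']
  have hcθ : 0 < c ^ θ := Real.rpow_pos_of_pos hc0 θ
  field_simp
  ring
end
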